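/- arXiv:2006.16576 — 2 statements merged into one kernel-verified Lean document; each statement's English description precedes it below -/
import Mathlib

section
/- Let R be an irreducible reduced crystallographic root system (not the union of two nonempty mutually orthogonal subsets) containing more than two elements, and let β ∈ R. Then q(β) ≤ 4; moreover, if (α_1, α_2, α_3, α_4) is any admissible sequence of length 4 for β, then β + α_1 + α_2 + α_3 + α_4 = −β. -/
open RealInnerProductSpace

variable {V : Type*} [NormedAddCommGroup V] [InnerProductSpace ℝ V]

/-- `R` is a reduced crystallographic root system in `V`. -/
def IsRootSystem (R : Set V) : Prop :=
  R.Finite ∧ (0 : V) ∉ R ∧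
    (∀ α ∈ R, ∀ β ∈ R,
      (∃ n : ℤ, 2 * ⟪β, α⟫ / ⟪α, α⟫ = (n : ℝ)) ∧
        β - (2 * ⟪β, α⟫ / ⟪α, α⟫) • α ∈ R) ∧
    ∀ α ∈ R, ∀ t : ℝ, t • α ∈ R → t = 1 ∨ t = -1

/-- `α` is an admissible sequence for `β`: each `αᵢ ∈ R`, `αᵢ + αⱼ ∉ R ∪ {0}` for
`i ≠ j`, and `β` plus any nonempty subset-sum of the `αᵢ` lies in `R`. -/
def IsAdmissible (R : Set V) (β : V) {k : ℕ} (α : Fin k → V) : Prop :=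
  (∀ i, α i ∈ R) ∧
    (∀ i j : Fin k, i ≠ j → α i + α j ∉ R ∧ α i + α j ≠ 0) ∧
    ∀ s : Finset (Fin k), s.Nonempty → β + ∑ i ∈ s, α i ∈ R

/-- The negative of a root is a root. -/
theorem IsRootSystem.neg_mem {R : Set V} (hR : IsRootSystem R) {x : V} (hx : x ∈ R) : -x ∈ R := by
  have h0 : ⟪x, x⟫ ≠ 0 := fun h => hR.2.1 (inner_self_eq_zero.mp h ▸ hx)
  have h := (hR.2.2.1 x hx x hx).2
  rw [mul_div_assoc, div_self h0] at h
  convert h using 1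
  module

theorem IsRootSystem.inner_self_pos {R : Set V} (hR : IsRootSystem R) {x : V} (hx : x ∈ R) :
    0 < ⟪x, x⟫ :=
  real_inner_self_pos.mpr fun h => hR.2.1 (h ▸ hx)

/-- Integrality and reflection for a pair of roots, without division. -/
theorem IsRootSystem.exists_int {R : Set V} (hR : IsRootSystem R) {x y : V}
    (hx : x ∈ R) (hy : y ∈ R) :
    ∃ n : ℤ, 2 * ⟪x, y⟫ = n * ⟪y, y⟫ ∧ x - (n : ℝ) • y ∈ R := by
  obtain ⟨⟨n, hn⟩, h⟩ := hR.2.2.1 y hy x hx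
  refine ⟨n, ?_, hn ▸ h⟩
  rw [← hn, div_mul_cancel₀ _ (hR.inner_self_pos hy).ne']

theorem inner_add_self (x y : V) : ⟪x + y, x + y⟫ = ⟪x, x⟫ + 2 * ⟪x, y⟫ + ⟪y, y⟫ := by
  rw [inner_add_left, inner_add_right, inner_add_right, real_inner_comm x y]
  ring

/-- The squared norm of `x - t • y`. -/
theorem inner_sub_smul_self (x y : V) (t : ℝ) :
    ⟪x - t • y, x - t • y⟫ = ⟪x, x⟫ - t * (2 * ⟪x, y⟫) + t ^ 2 * ⟪y, y⟫ := by
  rw [inner_sub_left, inner_sub_right, inner_sub_right, real_inner_smul_left,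
    real_inner_smul_left, real_inner_smul_right, real_inner_smul_right, real_inner_comm x y]
  ring

/-- Roots whose sum is neither a root nor zero form a non-obtuse angle. -/
theorem IsRootSystem.inner_nonneg {R : Set V} (hR : IsRootSystem R) {x y : V}
    (hx : x ∈ R) (hy : y ∈ R) (h : x + y ∉ R) (h0 : x + y ≠ 0) : 0 ≤ ⟪x, y⟫ := by
  wlog hle : ⟪x, x⟫ ≤ ⟪y, y⟫ generalizing x y
  · rw [real_inner_comm]
    exact this hy hx (add_comm x y ▸ h) (add_comm x y ▸ h0) (le_of_not_ge hle)
  by_contra! hneg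
  obtain ⟨n, hn, hmem⟩ := hR.exists_int hx hy
  have hy0 := hR.inner_self_pos hy
  have hpos := real_inner_self_pos.mpr h0
  rw [inner_add_self] at hpos
  have h1 : n < 0 := by
    by_contra! hc
    have : (0 : ℝ) ≤ n := by exact_mod_cast hc
    nlinarith
  have h2 : -2 < n := by
    by_contra! hc
    have : (n : ℝ) ≤ -2 := by exact_mod_cast hc
    nlinarith
  obtain rfl : n = -1 := by omega
  apply h
  convert hmem using 1
  push_cast
  module

/-- Squared lengths of non-orthogonal roots have ratio `1`, `2` or `3`. -/
theorem IsRootSystem.inner_self_ratio_of_inner_ne_zero {R : Set V} (hR : IsRootSystem R) {x y : V}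
    (hx : x ∈ R) (hy : y ∈ R) (h : ⟪x, y⟫ ≠ 0) (hle : ⟪x, x⟫ ≤ ⟪y, y⟫) :
    ⟪y, y⟫ = ⟪x, x⟫ ∨ ⟪y, y⟫ = 2 * ⟪x, x⟫ ∨ ⟪y, y⟫ = 3 * ⟪x, x⟫ := by
  wlog hpos : 0 < ⟪x, y⟫ generalizing y
  · have := this (y := -y) (hR.neg_mem hy) (by simpa using h) (by simpa using hle)
      (by rw [inner_neg_right]; have := lt_of_le_of_ne (not_lt.mp hpos) h; linarith)
    simpa using this
  obtain ⟨n, hn, -⟩ := hR.exists_int hx hy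
  obtain ⟨k, hk, -⟩ := hR.exists_int hy hx
  rw [real_inner_comm] at hk
  have hx0 := hR.inner_self_pos hx
  have hy0 := hR.inner_self_pos hy
  have n1 : 0 < n := by
    by_contra! hc
    have : (n : ℝ) ≤ 0 := by exact_mod_cast hc
    nlinarith
  have n2 : n ≤ 2 := by
    by_contra! hc
    have : (3 : ℝ) ≤ n := by exact_mod_cast hc
    have h1 := real_inner_self_nonneg (x := x - (1 : ℝ) • y)
    rw [inner_sub_smul_self] at h1
    nlinarith
  rcases (by omega : n = 1 ∨ n = 2) with rfl | rfl
  · have hsq := inner_sub_smul_self y x (k / 2)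
    rw [real_inner_comm x y] at hsq
    have hnn := real_inner_self_nonneg (x := y - ((k : ℝ) / 2) • x)
    push_cast at hn
    have hyk : ⟪y, y⟫ = k * ⟪x, x⟫ := by linarith
    have hsq' : ⟪y - ((k : ℝ) / 2) • x, y - ((k : ℝ) / 2) • x⟫ =
        (k - k ^ 2 / 4) * ⟪x, x⟫ := by rw [hsq, hk, hyk]; ring
    have k1 : 0 < k := by
      by_contra! hc
      have : (k : ℝ) ≤ 0 := by exact_mod_cast hc
      nlinarith
    have k2 : k < 5 := by
      by_contra! hc
      have : (5 : ℝ) ≤ k := by exact_mod_cast hc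
      rw [hsq'] at hnn
      nlinarith [nonneg_of_mul_nonneg_left hnn hx0]
    rcases (by omega : k = 1 ∨ k = 2 ∨ k = 3 ∨ k = 4) with rfl | rfl | rfl | rfl
    · left; simpa using hyk
    · right; left; simpa using hyk
    · right; right; simpa using hyk
    · exfalso
      norm_num at hsq'
      rw [sub_eq_zero] at hsq'
      have := hR.2.2.2 x hx 2 (hsq' ▸ hy)
      norm_num at this
  · left
    have h1 := real_inner_self_nonneg (x := x - (1 : ℝ) • y)
    rw [inner_sub_smul_self] at h1
    push_cast at hn
    linarith

/-- In an irreducible root system, squared lengths of any two roots have ratio `1`, `2` or `3`. -/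
theorem IsRootSystem.inner_self_ratio {R : Set V} (hR : IsRootSystem R)
    (hirr : ¬ ∃ R₁ R₂ : Set V, R₁.Nonempty ∧ R₂.Nonempty ∧ R = R₁ ∪ R₂ ∧
      ∀ a ∈ R₁, ∀ b ∈ R₂, ⟪a, b⟫ = (0 : ℝ)) {x y : V}
    (hx : x ∈ R) (hy : y ∈ R) (hle : ⟪x, x⟫ ≤ ⟪y, y⟫) :
    ⟪y, y⟫ = ⟪x, x⟫ ∨ ⟪y, y⟫ = 2 * ⟪x, x⟫ ∨ ⟪y, y⟫ = 3 * ⟪x, x⟫ := by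
  by_cases hz : ∃ z ∈ R, ⟪z, z⟫ = ⟪x, x⟫ ∧ ⟪z, y⟫ ≠ 0
  · obtain ⟨z, hz, hzx, hzy⟩ := hz
    rw [← hzx] at hle ⊢
    exact hR.inner_self_ratio_of_inner_ne_zero hz hy hzy hle
  exfalso
  apply hirr
  refine ⟨{b ∈ R | ∃ z ∈ R, ⟪z, z⟫ = ⟪x, x⟫ ∧ ⟪z, b⟫ ≠ 0},
    {b ∈ R | ¬ ∃ z ∈ R, ⟪z, z⟫ = ⟪x, x⟫ ∧ ⟪z, b⟫ ≠ 0},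
    ⟨x, hx, x, hx, rfl, (hR.inner_self_pos hx).ne'⟩, ⟨y, hy, hz⟩, ?_, ?_⟩
  · ext b
    refine ⟨fun hb => ?_, fun hb => hb.elim And.left And.left⟩
    exact (em _).imp (And.intro hb) (And.intro hb)
  · rintro b ⟨hb, z, hz, hzx, hzb⟩ d ⟨hd, hdz⟩
    push Not at hdz
    obtain ⟨n, hn, hmem⟩ := hR.exists_int hz hb
    have h1 := hdz z hz hzx
    have h2 := hdz _ hmem (by rw [inner_sub_smul_self, hn, ← hzx]; ring)
    rw [inner_sub_left, real_inner_smul_left, h1, zero_sub, neg_eq_zero] at h2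
    refine (mul_eq_zero.mp h2).resolve_left fun h => hzb ?_
    rw [h] at hn
    linarith

/-- An irreducible root system has at most two root lengths, recorded here by a function `e`
with values `0` (short) and `1` (long). If `x + y = z` for roots, then `z` is long whenever
both `x` and `y` are. -/
theorem IsRootSystem.exists_length {R : Set V} (hR : IsRootSystem R)
    (hirr : ¬ ∃ R₁ R₂ : Set V, R₁.Nonempty ∧ R₂.Nonempty ∧ R = R₁ ∪ R₂ ∧
      ∀ a ∈ R₁, ∀ b ∈ R₂, ⟪a, b⟫ = (0 : ℝ)) (hne : R.Nonempty) :
    ∃ (m h : ℝ) (e : V → ℤ), 0 < h ∧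
      (∀ x ∈ R, 0 ≤ e x ∧ e x ≤ 1 ∧ ⟪x, x⟫ = m + h * e x) ∧
      ∀ x ∈ R, ∀ y ∈ R, ∀ z ∈ R, z = x + y → e x + e y ≤ 1 + e z := by
  obtain ⟨x₀, hx₀, hmin⟩ := Set.exists_min_image R (fun x => ⟪x, x⟫) hR.1 hne
  have hm := hR.inner_self_pos hx₀
  obtain ⟨L, hL, hlen⟩ : ∃ L : ℤ, (L = 2 ∨ L = 3) ∧
      ∀ x ∈ R, ⟪x, x⟫ = ⟪x₀, x₀⟫ ∨ ⟪x, x⟫ = L * ⟪x₀, x₀⟫ := by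
    by_cases h3 : ∃ y ∈ R, ⟪y, y⟫ = 3 * ⟪x₀, x₀⟫
    · obtain ⟨y, hy, hy3⟩ := h3
      refine ⟨3, Or.inr rfl, fun x hx => ?_⟩
      rcases hR.inner_self_ratio hirr hx₀ hx (hmin x hx) with h | h | h
      · exact Or.inl h
      · exfalso
        rcases hR.inner_self_ratio hirr hx hy (by linarith) with h' | h' | h' <;> linarith
      · right; simpa using h
    · refine ⟨2, Or.inl rfl, fun x hx => ?_⟩
      rcases hR.inner_self_ratio hirr hx₀ hx (hmin x hx) with h | h | h
      · exact Or.inl h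
      · right; simpa using h
      · exact absurd ⟨x, hx, h⟩ h3
  have hL1 : (1 : ℝ) < L := by rcases hL with rfl | rfl <;> norm_num
  classical
  refine ⟨⟪x₀, x₀⟫, (L - 1) * ⟪x₀, x₀⟫, fun x => if ⟪x, x⟫ = ⟪x₀, x₀⟫ then 0 else 1,
    mul_pos (by linarith) hm, fun x hx => ?_, fun x hx y hy z hz hxyz => ?_⟩
  · dsimp only
    split_ifs with h
    · exact ⟨le_rfl, by norm_num, by rw [h]; push_cast; ring⟩
    · have := (hlen x hx).resolve_left h
      refine ⟨by norm_num, le_rfl, ?_⟩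
      rw [this]
      push_cast
      ring
  · dsimp only
    by_contra! hc
    have h : ⟪x, x⟫ ≠ ⟪x₀, x₀⟫ ∧ ⟪y, y⟫ ≠ ⟪x₀, x₀⟫ ∧ ⟪z, z⟫ = ⟪x₀, x₀⟫ := by
      split_ifs at hc <;> first | omega | exact ⟨‹_›, ‹_›, ‹_›⟩
    have h1 := (hlen x hx).resolve_left h.1
    have h2 := (hlen y hy).resolve_left h.2.1
    have h3 := h.2.2
    rw [hxyz, inner_add_self] at h3
    obtain ⟨n, hn, -⟩ := hR.exists_int hx hy
    have h4 : ((n * L + 2 * L - 1 : ℤ) : ℝ) * ⟪x₀, x₀⟫ = 0 := by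
      push_cast
      rw [hn, h1, h2] at h3
      linear_combination h3
    have h5 : n * L + 2 * L - 1 = 0 := by
      exact_mod_cast (mul_eq_zero.mp h4).resolve_right hm.ne'
    rcases hL with rfl | rfl <;> omega

/-- The third differences of the squared norm vanish. -/
theorem inner_self_third_difference (x a b c : V) :
    ⟪x + a + b + c, x + a + b + c⟫ =
      ⟪x + a + b, x + a + b⟫ + ⟪x + a + c, x + a + c⟫ + ⟪x + b + c, x + b + c⟫
        - ⟪x + a, x + a⟫ - ⟪x + b, x + b⟫ - ⟪x + c, x + c⟫ + ⟪x, x⟫ := by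
  repeat rw [inner_add_self]
  simp only [inner_add_left]
  ring

/-- If `A`, `x`, `y` are the `0/1`-lengths of roots two of which differ, up to sign, by the third,
then they are not two long and one short. -/
def LengthCompatible (A x y : ℤ) : Prop :=
  x + y ≤ 1 + A ∧ A + x ≤ 1 + y ∧ A + y ≤ 1 + x

/-- A supermodular `0/1`-valued function on the `3`-cube with vanishing third difference and no two
adjacent ones vanishes except at the bottom and the top. -/
theorem eq_zero_of_cube_three {e0 ea eb ec eab eac ebc eabc : ℤ}
    (b0 : 0 ≤ e0 ∧ e0 ≤ 1) (ba : 0 ≤ ea ∧ ea ≤ 1) (bb : 0 ≤ eb ∧ eb ≤ 1) (bc : 0 ≤ ec ∧ ec ≤ 1)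
    (bab : 0 ≤ eab ∧ eab ≤ 1) (bac : 0 ≤ eac ∧ eac ≤ 1) (bbc : 0 ≤ ebc ∧ ebc ≤ 1)
    (ha0 : LengthCompatible 0 e0 ea) (hb0 : LengthCompatible 0 e0 eb)
    (hc0 : LengthCompatible 0 e0 ec)
    (hba : LengthCompatible 0 ea eab) (hab : LengthCompatible 0 eb eab)
    (hac : LengthCompatible 0 ec eac)
    (hcab : LengthCompatible 0 eab eabc) (hbac : LengthCompatible 0 eac eabc)
    (habc : LengthCompatible 0 ebc eabc)
    (sab : ea + eb ≤ eab + e0) (sac : ea + ec ≤ eac + e0)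
    (t : eabc = eab + eac + ebc - ea - eb - ec + e0) :
    ea = 0 ∧ eb = 0 ∧ ec = 0 ∧ eab = 0 ∧ eac = 0 ∧ ebc = 0 := by
  have za : ea = 0 := by
    have := ha0.1; have := hba.1
    omega
  have zb : eb = 0 := by
    have := hb0.1; have := hab.1
    omega
  have zc : ec = 0 := by
    have := hc0.1; have := hac.1
    omega
  have := hcab.1; have := hbac.1; have := habc.1
  omega

/-- The average over the `4`-cube of the `0/1`-lengths of the partial sums of an admissible sequence
is at most the average `0/1`-length of its members. -/
theorem sum_cube_le {A B C D e0 ea eb ec ed eab eac ead ebc ebd ecd eabc eabd eacd ebcd eabcd : ℤ}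
    (b0 : 0 ≤ e0 ∧ e0 ≤ 1) (ba : 0 ≤ ea ∧ ea ≤ 1) (bb : 0 ≤ eb ∧ eb ≤ 1) (bc : 0 ≤ ec ∧ ec ≤ 1)
    (bd : 0 ≤ ed ∧ ed ≤ 1) (bab : 0 ≤ eab ∧ eab ≤ 1) (bac : 0 ≤ eac ∧ eac ≤ 1)
    (bad : 0 ≤ ead ∧ ead ≤ 1) (bbc : 0 ≤ ebc ∧ ebc ≤ 1) (bbd : 0 ≤ ebd ∧ ebd ≤ 1)
    (bcd : 0 ≤ ecd ∧ ecd ≤ 1) (babc : 0 ≤ eabc ∧ eabc ≤ 1) (babd : 0 ≤ eabd ∧ eabd ≤ 1)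
    (bacd : 0 ≤ eacd ∧ eacd ≤ 1) (bbcd : 0 ≤ ebcd ∧ ebcd ≤ 1) (babcd : 0 ≤ eabcd ∧ eabcd ≤ 1)
    (la : 0 ≤ A ∧ A ≤ 1) (lb : 0 ≤ B ∧ B ≤ 1) (lc : 0 ≤ C ∧ C ≤ 1) (ld : 0 ≤ D ∧ D ≤ 1)
    (ha0 : LengthCompatible A e0 ea) (hab : LengthCompatible A eb eab)
    (hac : LengthCompatible A ec eac) (had : LengthCompatible A ed ead)
    (habc : LengthCompatible A ebc eabc) (habd : LengthCompatible A ebd eabd)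
    (hacd : LengthCompatible A ecd eacd) (habcd : LengthCompatible A ebcd eabcd)
    (hb0 : LengthCompatible B e0 eb) (hba : LengthCompatible B ea eab)
    (hbc : LengthCompatible B ec ebc) (hbd : LengthCompatible B ed ebd)
    (hbac : LengthCompatible B eac eabc) (hbad : LengthCompatible B ead eabd)
    (hbcd : LengthCompatible B ecd ebcd) (hbacd : LengthCompatible B eacd eabcd)
    (hc0 : LengthCompatible C e0 ec) (hca : LengthCompatible C ea eac)
    (hcb : LengthCompatible C eb ebc) (hcd : LengthCompatible C ed ecd)
    (hcab : LengthCompatible C eab eabc) (hcad : LengthCompatible C ead eacd)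
    (hcbd : LengthCompatible C ebd ebcd) (hcabd : LengthCompatible C eabd eabcd)
    (hd0 : LengthCompatible D e0 ed) (hda : LengthCompatible D ea ead)
    (hdb : LengthCompatible D eb ebd) (hdc : LengthCompatible D ec ecd)
    (hdab : LengthCompatible D eab eabd) (hdac : LengthCompatible D eac eacd)
    (hdbc : LengthCompatible D ebc ebcd) (hdabc : LengthCompatible D eabc eabcd)
    (sab : ea + eb ≤ eab + e0) (sac : ea + ec ≤ eac + e0) (sad : ea + ed ≤ ead + e0)
    (sbc : eb + ec ≤ ebc + e0) (sbd : eb + ed ≤ ebd + e0)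
    (tabc : eabc = eab + eac + ebc - ea - eb - ec + e0)
    (tabd : eabd = eab + ead + ebd - ea - eb - ed + e0)
    (tacd : eacd = eac + ead + ecd - ea - ec - ed + e0)
    (tbcd : ebcd = ebc + ebd + ecd - eb - ec - ed + e0)
    (tabcd : eabcd = eabc + eabd + eacd - eab - eac - ead + ea) :
    e0 + ea + eb + ec + ed + eab + eac + ead + ebc + ebd + ecd + eabc + eabd + eacd + ebcd + eabcd
      ≤ 4 * (A + B + C + D) := by
  have Ha : e0 + ea + eb + ec + ed + eab + eac + ead + ebc + ebd + ecd + eabc + eabd + eacd + ebcd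
      + eabcd ≤ 8 + 8 * A := by
    linarith only [ha0.1, hab.1, hac.1, had.1, habc.1, habd.1, hacd.1, habcd.1]
  have Hb : e0 + ea + eb + ec + ed + eab + eac + ead + ebc + ebd + ecd + eabc + eabd + eacd + ebcd
      + eabcd ≤ 8 + 8 * B := by
    linarith only [hb0.1, hba.1, hbc.1, hbd.1, hbac.1, hbad.1, hbcd.1, hbacd.1]
  have Hc : e0 + ea + eb + ec + ed + eab + eac + ead + ebc + ebd + ecd + eabc + eabd + eacd + ebcd
      + eabcd ≤ 8 + 8 * C := by
    linarith only [hc0.1, hca.1, hcb.1, hcd.1, hcab.1, hcad.1, hcbd.1, hcabd.1]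
  have Hd : e0 + ea + eb + ec + ed + eab + eac + ead + ebc + ebd + ecd + eabc + eabd + eacd + ebcd
      + eabcd ≤ 8 + 8 * D := by
    linarith only [hd0.1, hda.1, hdb.1, hdc.1, hdab.1, hdac.1, hdbc.1, hdabc.1]
  have Tabc (za : A = 0) (zb : B = 0) (zc : C = 0) :
      ea = 0 ∧ eb = 0 ∧ ec = 0 ∧ eab = 0 ∧ eac = 0 ∧ ebc = 0 := by
    subst za zb zc
    exact eq_zero_of_cube_three b0 ba bb bc bab bac bbc ha0 hb0 hc0 hba hab hac hcab hbac habc sab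
      sac tabc
  have Tabd (za : A = 0) (zb : B = 0) (zd : D = 0) :
      ea = 0 ∧ eb = 0 ∧ ed = 0 ∧ eab = 0 ∧ ead = 0 ∧ ebd = 0 := by
    subst za zb zd
    exact eq_zero_of_cube_three b0 ba bb bd bab bad bbd ha0 hb0 hd0 hba hab had hdab hbad habd sab
      sad tabd
  have Tacd (za : A = 0) (zc : C = 0) (zd : D = 0) :
      ea = 0 ∧ ec = 0 ∧ ed = 0 ∧ eac = 0 ∧ ead = 0 ∧ ecd = 0 := by
    subst za zc zd
    exact eq_zero_of_cube_three b0 ba bc bd bac bad bcd ha0 hc0 hd0 hca hac had hdac hcad hacd sac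
      sad tacd
  have Tbcd (zb : B = 0) (zc : C = 0) (zd : D = 0) :
      eb = 0 ∧ ec = 0 ∧ ed = 0 ∧ ebc = 0 ∧ ebd = 0 ∧ ecd = 0 := by
    subst zb zc zd
    exact eq_zero_of_cube_three b0 bb bc bd bbc bbd bcd hb0 hc0 hd0 hcb hbc hbd hdbc hcbd hbcd sbc
      sbd tbcd
  rcases (by clear * - la lb lc ld; omega :
      4 ≤ A + B + C + D ∨ (2 ≤ A + B + C + D ∧ A + B + C + D ≤ 3) ∨
      (A = 0 ∧ B = 0 ∧ C = 0 ∧ D = 0) ∨ (A = 0 ∧ B = 0 ∧ C = 0 ∧ D = 1) ∨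
      (A = 0 ∧ B = 0 ∧ C = 1 ∧ D = 0) ∨ (A = 0 ∧ B = 1 ∧ C = 0 ∧ D = 0) ∨
      (A = 1 ∧ B = 0 ∧ C = 0 ∧ D = 0)) with
    h | h | ⟨zA, zB, zC, zD⟩ | ⟨zA, zB, zC, zD⟩ | ⟨zA, zB, zC, zD⟩ | ⟨zA, zB, zC, zD⟩ |
    ⟨zA, zB, zC, zD⟩
  · linarith only [h, la, Ha]
  · rcases (by clear * - h la lb lc ld; omega : A = 0 ∨ B = 0 ∨ C = 0 ∨ D = 0) with z | z | z | z
    · linarith only [h, z, Ha]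
    · linarith only [h, z, Hb]
    · linarith only [h, z, Hc]
    · linarith only [h, z, Hd]
  · have h1 := Tabc zA zB zC
    have h2 := Tabd zA zB zD
    have h3 := Tacd zA zC zD
    have h4 := Tbcd zB zC zD
    clear * - h1 h2 h3 h4 b0 babcd tabc tabd tacd tbcd tabcd zA zB zC zD
    omega
  · have h1 := Tabc zA zB zC
    have hd0' := hd0.2.2
    have hda' := hda.2.2
    have hdb' := hdb.2.2
    have hdc' := hdc.2.2
    have hdab' := hdab.2.2
    have hdac' := hdac.2.2
    have hdbc' := hdbc.2.2
    have hdabc' := hdabc.2.2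
    clear * - h1 b0 babc zA zB zC zD hd0' hda' hdb' hdc' hdab' hdac' hdbc' hdabc'
    omega
  · have h1 := Tabd zA zB zD
    have hc0' := hc0.2.2
    have hca' := hca.2.2
    have hcb' := hcb.2.2
    have hcd' := hcd.2.2
    have hcab' := hcab.2.2
    have hcad' := hcad.2.2
    have hcbd' := hcbd.2.2
    have hcabd' := hcabd.2.2
    clear * - h1 b0 babd zA zB zC zD hc0' hca' hcb' hcd' hcab' hcad' hcbd' hcabd'
    omega
  · have h1 := Tacd zA zC zD
    have hb0' := hb0.2.2
    have hba' := hba.2.2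
    have hbc' := hbc.2.2
    have hbd' := hbd.2.2
    have hbac' := hbac.2.2
    have hbad' := hbad.2.2
    have hbcd' := hbcd.2.2
    have hbacd' := hbacd.2.2
    clear * - h1 b0 bacd zA zB zC zD hb0' hba' hbc' hbd' hbac' hbad' hbcd' hbacd'
    omega
  · have h1 := Tbcd zB zC zD
    have ha0' := ha0.2.2
    have hab' := hab.2.2
    have hac' := hac.2.2
    have had' := had.2.2
    have habc' := habc.2.2
    have habd' := habd.2.2
    have hacd' := hacd.2.2
    have habcd' := habcd.2.2
    clear * - h1 b0 bbcd zA zB zC zD ha0' hab' hac' had' habc' habd' hacd' habcd'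
    omega

/-- An admissible sequence of length four sums to `-2β`. -/
theorem IsAdmissible.add_sum_eq_neg {R : Set V} (hR : IsRootSystem R)
    (hirr : ¬ ∃ R₁ R₂ : Set V, R₁.Nonempty ∧ R₂.Nonempty ∧ R = R₁ ∪ R₂ ∧
      ∀ a ∈ R₁, ∀ b ∈ R₂, ⟪a, b⟫ = (0 : ℝ))
    {β : V} (hβ : β ∈ R) {α : Fin 4 → V} (hα : IsAdmissible R β α) :
    β + (α 0 + α 1 + α 2 + α 3) = -β := by
  obtain ⟨m, h, e, hh, he, hadd⟩ := hR.exists_length hirr ⟨β, hβ⟩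
  have edge : ∀ i, ∀ x ∈ R, ∀ y ∈ R, y = x + α i → LengthCompatible (e (α i)) (e x) (e y) := by
    intro i x hx y hy hxy
    have e_neg : ∀ z ∈ R, e (-z) = e z := by
      intro z hz
      have h1 := (he z hz).2.2
      have h2 := (he _ (hR.neg_mem hz)).2.2
      rw [inner_neg_neg, h1] at h2
      exact_mod_cast (mul_left_cancel₀ hh.ne' (add_left_cancel h2)).symm
    have hi := hα.1 i
    have h1 := hadd _ hy _ (hR.neg_mem hx) _ hi (by rw [hxy]; abel)
    have h2 := hadd _ hi _ hx _ hy (by rw [hxy]; abel)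
    have h3 := hadd _ hy _ (hR.neg_mem hi) _ hx (by rw [hxy]; abel)
    rw [e_neg _ hx] at h1
    rw [e_neg _ hi] at h3
    exact ⟨by linarith, h2, by linarith⟩
  have super : ∀ i j, i ≠ j → β + α i ∈ R → β + α j ∈ R → β + α i + α j ∈ R →
      e (β + α i) + e (β + α j) ≤ e (β + α i + α j) + e β := by
    intro i j hij hi hj hk
    have h1 := hR.inner_nonneg (hα.1 i) (hα.1 j) (hα.2.1 i j hij).1 (hα.2.1 i j hij).2
    have h2 : ⟪β + α i + α j, β + α i + α j⟫ + ⟪β, β⟫ =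
        ⟪β + α i, β + α i⟫ + ⟪β + α j, β + α j⟫ + 2 * ⟪α i, α j⟫ := by
      repeat rw [inner_add_self]
      rw [inner_add_left]
      ring
    rw [(he _ hi).2.2, (he _ hj).2.2, (he _ hk).2.2, (he _ hβ).2.2] at h2
    have h3 : h * ((e (β + α i) + e (β + α j) : ℤ) : ℝ) ≤
        h * ((e (β + α i + α j) + e β : ℤ) : ℝ) := by
      push_cast
      linarith
    exact_mod_cast le_of_mul_le_mul_left h3 hh
  have third : ∀ x a b c : V, x ∈ R → x + a ∈ R → x + b ∈ R → x + c ∈ R → x + a + b ∈ R →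
      x + a + c ∈ R → x + b + c ∈ R → x + a + b + c ∈ R →
      e (x + a + b + c) = e (x + a + b) + e (x + a + c) + e (x + b + c)
        - e (x + a) - e (x + b) - e (x + c) + e x := by
    intro x a b c h0 h1 h2 h3 h4 h5 h6 h7
    have h8 := inner_self_third_difference x a b c
    rw [(he _ h0).2.2, (he _ h1).2.2, (he _ h2).2.2, (he _ h3).2.2, (he _ h4).2.2,
      (he _ h5).2.2, (he _ h6).2.2, (he _ h7).2.2] at h8
    have h9 : h * (e (x + a + b + c) : ℝ) = h * ((e (x + a + b) + e (x + a + c) + e (x + b + c)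
        - e (x + a) - e (x + b) - e (x + c) + e x : ℤ) : ℝ) := by
      push_cast
      linarith
    exact_mod_cast mul_left_cancel₀ hh.ne' h9
  have m0 := hβ
  have ma : β + α 0 ∈ R := by
    simpa [add_assoc] using hα.2.2 {0} (by simp)
  have mb : β + α 1 ∈ R := by
    simpa [add_assoc] using hα.2.2 {1} (by simp)
  have mc : β + α 2 ∈ R := by
    simpa [add_assoc] using hα.2.2 {2} (by simp)
  have md : β + α 3 ∈ R := by
    simpa [add_assoc] using hα.2.2 {3} (by simp)
  have mab : β + α 0 + α 1 ∈ R := by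
    simpa [add_assoc] using hα.2.2 {0, 1} (by simp)
  have mac : β + α 0 + α 2 ∈ R := by
    simpa [add_assoc] using hα.2.2 {0, 2} (by simp)
  have mad : β + α 0 + α 3 ∈ R := by
    simpa [add_assoc] using hα.2.2 {0, 3} (by simp)
  have mbc : β + α 1 + α 2 ∈ R := by
    simpa [add_assoc] using hα.2.2 {1, 2} (by simp)
  have mbd : β + α 1 + α 3 ∈ R := by
    simpa [add_assoc] using hα.2.2 {1, 3} (by simp)
  have mcd : β + α 2 + α 3 ∈ R := by
    simpa [add_assoc] using hα.2.2 {2, 3} (by simp)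
  have mabc : β + α 0 + α 1 + α 2 ∈ R := by
    simpa [add_assoc] using hα.2.2 {0, 1, 2} (by simp)
  have mabd : β + α 0 + α 1 + α 3 ∈ R := by
    simpa [add_assoc] using hα.2.2 {0, 1, 3} (by simp)
  have macd : β + α 0 + α 2 + α 3 ∈ R := by
    simpa [add_assoc] using hα.2.2 {0, 2, 3} (by simp)
  have mbcd : β + α 1 + α 2 + α 3 ∈ R := by
    simpa [add_assoc] using hα.2.2 {1, 2, 3} (by simp)
  have mabcd : β + α 0 + α 1 + α 2 + α 3 ∈ R := by
    simpa [add_assoc] using hα.2.2 {0, 1, 2, 3} (by simp)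
  have bound : ∀ x ∈ R, 0 ≤ e x ∧ e x ≤ 1 := fun x hx => ⟨(he x hx).1, (he x hx).2.1⟩
  have key := sum_cube_le
    (bound _ m0) (bound _ ma) (bound _ mb) (bound _ mc) (bound _ md) (bound _ mab) (bound _ mac)
    (bound _ mad) (bound _ mbc) (bound _ mbd) (bound _ mcd) (bound _ mabc) (bound _ mabd)
    (bound _ macd) (bound _ mbcd) (bound _ mabcd) (bound _ (hα.1 0)) (bound _ (hα.1 1))
    (bound _ (hα.1 2)) (bound _ (hα.1 3)) (edge 0 _ m0 _ ma (by abel))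
    (edge 0 _ mb _ mab (by abel)) (edge 0 _ mc _ mac (by abel)) (edge 0 _ md _ mad (by abel))
    (edge 0 _ mbc _ mabc (by abel)) (edge 0 _ mbd _ mabd (by abel))
    (edge 0 _ mcd _ macd (by abel)) (edge 0 _ mbcd _ mabcd (by abel)) (edge 1 _ m0 _ mb (by abel))
    (edge 1 _ ma _ mab (by abel)) (edge 1 _ mc _ mbc (by abel)) (edge 1 _ md _ mbd (by abel))
    (edge 1 _ mac _ mabc (by abel)) (edge 1 _ mad _ mabd (by abel))
    (edge 1 _ mcd _ mbcd (by abel)) (edge 1 _ macd _ mabcd (by abel)) (edge 2 _ m0 _ mc (by abel))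
    (edge 2 _ ma _ mac (by abel)) (edge 2 _ mb _ mbc (by abel)) (edge 2 _ md _ mcd (by abel))
    (edge 2 _ mab _ mabc (by abel)) (edge 2 _ mad _ macd (by abel))
    (edge 2 _ mbd _ mbcd (by abel)) (edge 2 _ mabd _ mabcd (by abel)) (edge 3 _ m0 _ md (by abel))
    (edge 3 _ ma _ mad (by abel)) (edge 3 _ mb _ mbd (by abel)) (edge 3 _ mc _ mcd (by abel))
    (edge 3 _ mab _ mabd (by abel)) (edge 3 _ mac _ macd (by abel))
    (edge 3 _ mbc _ mbcd (by abel)) (edge 3 _ mabc _ mabcd (by abel))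
    (super 0 1 (by decide) ma mb mab) (super 0 2 (by decide) ma mc mac)
    (super 0 3 (by decide) ma md mad) (super 1 2 (by decide) mb mc mbc)
    (super 1 3 (by decide) mb md mbd) (third _ _ _ _ m0 ma mb mc mab mac mbc mabc)
    (third _ _ _ _ m0 ma mb md mab mad mbd mabd) (third _ _ _ _ m0 ma mc md mac mad mcd macd)
    (third _ _ _ _ m0 mb mc md mbc mbd mcd mbcd)
    (third _ _ _ _ ma mab mac mad mabc mabd macd mabcd)
  have key' : h * ((e β + e (β + α 0) + e (β + α 1) + e (β + α 2) + e (β + α 3) + e (β + α 0 + α 1)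
      + e (β + α 0 + α 2) + e (β + α 0 + α 3) + e (β + α 1 + α 2) + e (β + α 1 + α 3) + e (β + α 2
      + α 3) + e (β + α 0 + α 1 + α 2) + e (β + α 0 + α 1 + α 3) + e (β + α 0 + α 2 + α 3) + e (β +
      α 1 + α 2 + α 3) + e (β + α 0 + α 1 + α 2 + α 3) : ℤ) : ℝ) ≤
      h * ((4 * (e (α 0) + e (α 1) + e (α 2) + e (α 3)) : ℤ) : ℝ) :=
    mul_le_mul_of_nonneg_left (by exact_mod_cast key) hh.le
  have total : 4 * ⟪β + β + (α 0 + α 1 + α 2 + α 3), β + β + (α 0 + α 1 + α 2 + α 3)⟫ +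
      4 * (⟪α 0, α 0⟫ + ⟪α 1, α 1⟫ + ⟪α 2, α 2⟫ + ⟪α 3, α 3⟫) =
      ⟪β, β⟫ + ⟪β + α 0, β + α 0⟫ + ⟪β + α 1, β + α 1⟫ + ⟪β + α 2, β + α 2⟫ + ⟪β + α 3, β + α 3⟫ +
          ⟪β + α 0 + α 1, β + α 0 + α 1⟫ + ⟪β + α 0 + α 2, β + α 0 + α 2⟫ + ⟪β + α 0 + α 3, β + α 0
          + α 3⟫ + ⟪β + α 1 + α 2, β + α 1 + α 2⟫ + ⟪β + α 1 + α 3, β + α 1 + α 3⟫ + ⟪β + α 2 + α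
          3, β + α 2 + α 3⟫ + ⟪β + α 0 + α 1 + α 2, β + α 0 + α 1 + α 2⟫ + ⟪β + α 0 + α 1 + α 3, β
          + α 0 + α 1 + α 3⟫ + ⟪β + α 0 + α 2 + α 3, β + α 0 + α 2 + α 3⟫ + ⟪β + α 1 + α 2 + α 3, β
          + α 1 + α 2 + α 3⟫ + ⟪β + α 0 + α 1 + α 2 + α 3, β + α 0 + α 1 + α 2 + α 3⟫ := by
    repeat rw [inner_add_self]
    simp only [inner_add_left, inner_add_right]
    ring
  rw [(he _ (hα.1 0)).2.2, (he _ (hα.1 1)).2.2, (he _ (hα.1 2)).2.2, (he _ (hα.1 3)).2.2, (he _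
      m0).2.2, (he _ ma).2.2, (he _ mb).2.2, (he _ mc).2.2, (he _ md).2.2, (he _ mab).2.2, (he _
      mac).2.2, (he _ mad).2.2, (he _ mbc).2.2, (he _ mbd).2.2, (he _ mcd).2.2, (he _ mabc).2.2,
      (he _ mabd).2.2, (he _ macd).2.2, (he _ mbcd).2.2, (he _ mabcd).2.2] at total
  push_cast at key'
  have hle : ⟪β + β + (α 0 + α 1 + α 2 + α 3), β + β + (α 0 + α 1 + α 2 + α 3)⟫ ≤ 0 := by
    linarith only [total, key']
  have hz := real_inner_self_nonpos.mp hle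
  rw [eq_neg_iff_add_eq_zero, ← hz]
  abel

/-- Precomposing with an injection preserves admissibility. -/
theorem IsAdmissible.comp {W : Type*} [NormedAddCommGroup W] {R : Set W} {β : W} {k l : ℕ}
    {α : Fin k → W} (hα : IsAdmissible R β α) (g : Fin l ↪ Fin k) : IsAdmissible R β (α ∘ g) := by
  refine ⟨fun i => hα.1 _, fun i j hij => hα.2.1 _ _ (g.injective.ne hij), fun s hs => ?_⟩
  have := hα.2.2 (s.map g) (hs.map)
  rwa [Finset.sum_map] at this

/-- For an irreducible reduced crystallographic root system with more than two
elements, `q(β) ≤ 4` for every root `β`, and any admissible sequence of length `4`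
sums with `β` to `−β`. -/
theorem admissible_le_four [FiniteDimensional ℝ V]
    (R : Set V) (hR : IsRootSystem R)
    (hirr : ¬ ∃ R₁ R₂ : Set V, R₁.Nonempty ∧ R₂.Nonempty ∧ R = R₁ ∪ R₂ ∧
      ∀ a ∈ R₁, ∀ b ∈ R₂, ⟪a, b⟫ = (0 : ℝ))
    (hcard : 2 < R.ncard)
    (β : V) (hβ : β ∈ R) :
    (∀ (k : ℕ) (α : Fin k → V), IsAdmissible R β α → k ≤ 4) ∧
      ∀ α : Fin 4 → V, IsAdmissible R β α →
        β + (α 0 + α 1 + α 2 + α 3) = -β := by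
  refine ⟨fun k α hα => ?_, fun α hα => hα.add_sum_eq_neg hR hirr hβ⟩
  by_contra! hk
  have h5 := hα.comp (Fin.castLEEmb hk)
  generalize α ∘ Fin.castLEEmb hk = γ at h5
  have h0 := (h5.comp (Fin.succAboveEmb 0)).add_sum_eq_neg hR hirr hβ
  have h1 := (h5.comp (Fin.succAboveEmb 1)).add_sum_eq_neg hR hirr hβ
  have h2 := (h5.comp (Fin.succAboveEmb 2)).add_sum_eq_neg hR hirr hβ
  have h3 := (h5.comp (Fin.succAboveEmb 3)).add_sum_eq_neg hR hirr hβ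
  have h4 := (h5.comp (Fin.succAboveEmb 4)).add_sum_eq_neg hR hirr hβ
  change β + (γ 1 + γ 2 + γ 3 + γ 4) = -β at h0
  change β + (γ 0 + γ 2 + γ 3 + γ 4) = -β at h1
  change β + (γ 0 + γ 1 + γ 3 + γ 4) = -β at h2
  change β + (γ 0 + γ 1 + γ 2 + γ 4) = -β at h3
  change β + (γ 0 + γ 1 + γ 2 + γ 3) = -β at h4
  have h6 : β = (-2 : ℝ) • γ 0 := by
    linear_combination (norm := module) (-3 / 2 : ℝ) • h0 + (1 / 2 : ℝ) • (h1 + h2 + h3 + h4)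
  have := hR.2.2.2 (γ 0) (h5.1 0) (-2) (h6 ▸ hβ)
  norm_num at this
end

section
/- For every β ∈ Q with σ(β) ∉ Q whose Levi order q^σ(β) is finite, one has q^σ(β) ≤ 3. (In particular, a fundamental and weakly nondegenerate real orbit of a real form in a complex flag manifold has Levi order at most 3.) -/
open RealInnerProductSpace

variable {V : Type*} [NormedAddCommGroup V] [InnerProductSpace ℝ V]

/-- The partial sum `β + α₁ + ⋯ + α_h` of the first `h` terms of a sequence. -/
def partialSum (β : V) {k : ℕ} (α : Fin k → V) (h : ℕ) : V :=
  β + ∑ i ∈ Finset.univ.filter (fun i : Fin k => (i : ℕ) < h), α i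

/-- `α` is a Levi chain of length `k` for `β`: all `σ(αᵢ) ∈ Q`, all partial sums
`β + α₁ + ⋯ + α_h` (`1 ≤ h ≤ k`) are roots, and the final sum `γ` satisfies
`γ ∉ Q` and `σ(γ) ∉ Q`. -/
def IsLeviChain (R Q : Set V) (σ : V →ₗ[ℝ] V) (β : V) {k : ℕ} (α : Fin k → V) : Prop :=
  (∀ i, α i ∈ R ∧ σ (α i) ∈ Q) ∧
    (∀ h : ℕ, 1 ≤ h → h ≤ k → partialSum β α h ∈ R) ∧
    partialSum β α k ∉ Q ∧ σ (partialSum β α k) ∉ Q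

/-- The Levi order `q^σ(β)`: the minimal length of a Levi chain for `β`,
or `⊤` if no Levi chain for `β` exists. -/
noncomputable def leviOrder (R Q : Set V) (σ : V →ₗ[ℝ] V) (β : V) : ℕ∞ :=
  sInf {m : ℕ∞ | ∃ (k : ℕ) (α : Fin k → V), m = (k : ℕ∞) ∧ IsLeviChain R Q σ β α}

namespace IsRootSystem

variable {R : Set V}

theorem neg_mem_s15 (hR : IsRootSystem R) {x : V} (hx : x ∈ R) : -x ∈ R := by
  have hx0 : x ≠ 0 := fun h => hR.2.1 (h ▸ hx)
  have h := (hR.2.2.1 x hx x hx).2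
  rw [mul_div_assoc, div_self (inner_self_ne_zero.mpr hx0), mul_one, two_smul] at h
  simpa using h

theorem inner_self_pos_s15 (hR : IsRootSystem R) {x : V} (hx : x ∈ R) : 0 < ⟪x, x⟫ :=
  real_inner_self_pos.mpr fun h => hR.2.1 (h ▸ hx)

theorem sub_mem_or_le_inner (hR : IsRootSystem R) {x y : V} (hx : x ∈ R) (hy : y ∈ R)
    (h : 0 < ⟪x, y⟫) : x - y ∈ R ∨ ⟪y, y⟫ ≤ ⟪x, y⟫ := by
  obtain ⟨⟨n, hn⟩, hmem⟩ := hR.2.2.1 y hy x hx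
  have hpos := hR.inner_self_pos_s15 hy
  have hn0 : (0 : ℝ) < n := hn ▸ by positivity
  have hn1 : 1 ≤ n := by exact_mod_cast hn0
  rcases hn1.eq_or_lt with h1 | h1
  · left
    rwa [hn, ← h1, Int.cast_one, one_smul] at hmem
  · right
    have h2 : (2 : ℝ) ≤ n := by exact_mod_cast h1
    rw [← hn, le_div_iff₀ hpos] at h2
    linarith

/-- Two roots at an acute angle are equal or differ by a root. -/
theorem eq_or_sub_mem (hR : IsRootSystem R) {x y : V} (hx : x ∈ R) (hy : y ∈ R)
    (h : 0 < ⟪x, y⟫) : x = y ∨ x - y ∈ R := by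
  rcases hR.sub_mem_or_le_inner hx hy h with h1 | h1
  · exact Or.inr h1
  rcases hR.sub_mem_or_le_inner hy hx (by rwa [real_inner_comm]) with h2 | h2
  · exact Or.inr (by simpa using hR.neg_mem_s15 h2)
  left
  have h3 : ⟪x - y, x - y⟫ ≤ 0 := by
    rw [real_inner_sub_sub_self]
    linarith [real_inner_comm x y]
  exact sub_eq_zero.mp (real_inner_self_nonpos.mp h3)

end IsRootSystem

/-- A step from `u` to the root `w` along a root on which `η` is nonpositive. -/
def RootStep (R : Set V) (η : V →ₗ[ℝ] ℝ) (u w : V) : Prop :=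
  w ∈ R ∧ w - u ∈ R ∧ η (w - u) ≤ 0

/-- `v` is reached from `u` by `n` successive root steps. -/
def RootReach (R : Set V) (η : V →ₗ[ℝ] ℝ) : ℕ → V → V → Prop
  | 0, u, v => u = v
  | n + 1, u, v => ∃ w, RootStep R η u w ∧ RootReach R η n w v

section Reach

variable {R : Set V} {η : V →ₗ[ℝ] ℝ}

theorem RootStep.le {u w : V} (h : RootStep R η u w) : η w ≤ η u := by
  have := h.2.2
  rw [map_sub] at this
  linarith

theorem RootReach.le {n : ℕ} {u v : V} (h : RootReach R η n u v) : η v ≤ η u := by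
  induction n generalizing u with
  | zero => exact (congrArg η h).ge
  | succ n ih =>
    obtain ⟨w, hw, h⟩ := h
    exact (ih h).trans hw.le

theorem RootReach.trans {m n : ℕ} {u v w : V} (h : RootReach R η m u v)
    (h' : RootReach R η n v w) : RootReach R η (m + n) u w := by
  induction m generalizing u with
  | zero =>
    obtain rfl : u = v := h
    rwa [Nat.zero_add]
  | succ m ih =>
    obtain ⟨x, hx, h⟩ := h
    rw [Nat.succ_add]
    exact ⟨x, hx, ih h⟩

theorem RootReach.exists_of_add {m n : ℕ} {u w : V} (h : RootReach R η (m + n) u w) :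
    ∃ v, RootReach R η m u v ∧ RootReach R η n v w := by
  induction m generalizing u with
  | zero => exact ⟨u, rfl, by rwa [Nat.zero_add] at h⟩
  | succ m ih =>
    rw [Nat.succ_add] at h
    obtain ⟨x, hx, h⟩ := h
    obtain ⟨v, h1, h2⟩ := ih h
    exact ⟨v, ⟨x, hx, h1⟩, h2⟩

/-- Two consecutive steps which cannot be merged can be interchanged. -/
theorem RootStep.swap (hR : IsRootSystem R) {u v w : V} (hu : u ∈ R) (hw0 : 0 < η w)
    (huv : RootStep R η u v) (hvw : RootStep R η v w) (hne : u ≠ w)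
    (hstep : ¬ RootStep R η u w) :
    RootStep R η u (u + (w - v)) ∧ RootStep R η (u + (w - v)) w := by
  have ha := huv.2.2
  have hb := hvw.2.2
  have hle : η (w - u) ≤ 0 := by
    rw [map_sub] at *
    linarith
  have hnR : w - u ∉ R := fun h => hstep ⟨hvw.1, h, hle⟩
  suffices hmem : u + (w - v) ∈ R by
    refine ⟨⟨hmem, by simpa using hvw.2.1, by simpa using hb⟩, hvw.1, ?_⟩
    rw [show w - (u + (w - v)) = v - u by abel]
    exact huv.2
  by_contra hnot
  have hwa : w ≠ v - u := fun h => by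
    rw [← h] at ha
    linarith
  have h1 : ⟪w, u⟫ ≤ 0 := by
    by_contra! h
    rcases hR.eq_or_sub_mem hvw.1 hu h with h | h
    · exact hne h.symm
    · exact hnR h
  have h2 : ⟪w, v - u⟫ ≤ 0 := by
    by_contra! h
    rcases hR.eq_or_sub_mem hvw.1 huv.2.1 h with h | h
    · exact hwa h
    · exact hnot (by rwa [show u + (w - v) = w - (v - u) by abel])
  have h3 : 0 ≤ ⟪v - u, w - v⟫ := by
    by_contra! h
    rcases hR.eq_or_sub_mem huv.2.1 (hR.neg_mem_s15 hvw.2.1)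
      (by rw [inner_neg_right]; linarith) with h | h
    · rw [neg_sub, sub_eq_sub_iff_add_eq_add] at h
      exact hne (add_left_cancel h).symm
    · exact hnR (by rwa [show w - u = v - u - -(w - v) by abel])
  have h4 : 0 ≤ ⟪u, w - v⟫ := by
    by_contra! h
    rcases hR.eq_or_sub_mem hu (hR.neg_mem_s15 hvw.2.1)
      (by rw [inner_neg_right]; linarith) with h | h
    · exact hwa (by rw [h]; abel)
    · exact hnot (by rwa [sub_neg_eq_add] at h)
  have h5 := hR.inner_self_pos_s15 huv.1
  simp only [inner_sub_left, inner_sub_right] at h2 h3 h4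
  linarith [real_inner_comm v w]

/-- Four steps between roots on which `η` is positive can be replaced by at most three. -/
theorem RootReach.exists_le_three (hR : IsRootSystem R) {u z : V} (hu : u ∈ R) (hz : 0 < η z)
    (h : RootReach R η 4 u z) : ∃ m ≤ 3, RootReach R η m u z := by
  by_contra! hno
  have no1 : ¬ RootStep R η u z := fun h => hno 1 (by norm_num) ⟨z, h, rfl⟩
  have no2 : ∀ x, RootStep R η u x → ¬ RootStep R η x z := fun x h1 h2 =>
    hno 2 (by norm_num) ⟨x, h1, z, h2, rfl⟩
  have no3 : ∀ x y, RootStep R η u x → RootStep R η x y → ¬ RootStep R η y z :=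
    fun x y h1 h2 h3 => hno 3 le_rfl ⟨x, h1, y, h2, z, h3, rfl⟩
  have swap_fst : ∀ a b c, RootStep R η u a → RootStep R η a b → RootStep R η b c →
      RootStep R η c z → RootStep R η u (u + (b - a)) ∧ RootStep R η (u + (b - a)) b :=
    fun a b c h1 h2 h3 h4 => h1.swap hR hu (by linarith [h3.le, h4.le]) h2
      (by rintro rfl; exact no2 c h3 h4) fun h => no3 b c h h3 h4
  have swap_mid : ∀ a b c, RootStep R η u a → RootStep R η a b → RootStep R η b c →
      RootStep R η c z → RootStep R η a (a + (c - b)) ∧ RootStep R η (a + (c - b)) c :=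
    fun a b c h1 h2 h3 h4 => h2.swap hR h1.1 (by linarith [h4.le]) h3
      (by rintro rfl; exact no2 a h1 h4) fun h => no3 a c h1 h h4
  have swap_last : ∀ a b c, RootStep R η u a → RootStep R η a b → RootStep R η b c →
      RootStep R η c z → RootStep R η b (b + (z - c)) ∧ RootStep R η (b + (z - c)) z :=
    fun a b c h1 h2 h3 h4 => h3.swap hR h2.1 hz h4
      (by rintro rfl; exact no2 a h1 h2) fun h => no3 a b h1 h2 h
  have obtuse : ∀ a b c, RootStep R η u a → RootStep R η a b → RootStep R η b c →
      RootStep R η c z → ⟪b, u⟫ ≤ 0 ∧ ⟪z, b⟫ ≤ 0 := by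
    intro a b c h1 h2 h3 h4
    constructor
    · by_contra! h
      rcases hR.eq_or_sub_mem h2.1 hu h with h | h
      · exact no2 c (h ▸ h3) h4
      · refine no3 b c ⟨h2.1, h, ?_⟩ h3 h4
        rw [map_sub]
        linarith [h1.le, h2.le]
    · by_contra! h
      rcases hR.eq_or_sub_mem h4.1 h2.1 h with h | h
      · exact no2 a h1 (h ▸ h2)
      · refine no3 a b h1 h2 ⟨h4.1, h, ?_⟩
        rw [map_sub]
        linarith [h3.le, h4.le]
  obtain ⟨a, h1, b, h2, c, h3, z', h4, rfl⟩ := h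
  obtain ⟨k2, k3⟩ := swap_mid _ _ _ h1 h2 h3 h4
  obtain ⟨l1, l2⟩ := swap_fst _ _ _ h1 k2 k3 h4
  obtain ⟨m3, m4⟩ := swap_last _ _ _ l1 l2 k3 h4
  obtain ⟨n2, n3⟩ := swap_mid _ _ _ l1 l2 m3 m4
  obtain ⟨o1, o2⟩ := obtuse _ _ _ h1 h2 h3 h4
  obtain ⟨o3, o4⟩ := obtuse _ _ _ l1 n2 n3 m4
  have hsum : ⟪u + z', u + z'⟫ ≤ 0 := by
    simp only [inner_add_left, inner_add_right, inner_sub_left, inner_sub_right] at o1 o2 o3 o4 ⊢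
    linarith [real_inner_comm u z']
  have h0 := congrArg η (real_inner_self_nonpos.mp hsum)
  rw [map_add, map_zero] at h0
  linarith [h1.le, h2.le, h3.le, h4.le]

theorem partialSum_succ (β : V) {k : ℕ} (α : Fin (k + 1) → V) (h : ℕ) :
    partialSum β α (h + 1) = partialSum (β + α 0) (fun i => α i.succ) h := by
  simp [partialSum, Finset.sum_filter, Fin.sum_univ_succ, add_assoc]

theorem partialSum_zero (β : V) {k : ℕ} (α : Fin k → V) : partialSum β α 0 = β := by
  simp [partialSum]

theorem rootReach_iff {k : ℕ} {β γ : V} :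
    RootReach R η k β γ ↔ ∃ α : Fin k → V, (∀ i, α i ∈ R ∧ η (α i) ≤ 0) ∧
      (∀ h, 1 ≤ h → h ≤ k → partialSum β α h ∈ R) ∧ partialSum β α k = γ := by
  induction k generalizing β with
  | zero =>
    constructor
    · rintro rfl
      exact ⟨Fin.elim0, fun i => i.elim0, fun h h1 h2 => by omega, partialSum_zero _ _⟩
    · rintro ⟨α, -, -, h⟩
      rwa [partialSum_zero] at h
  | succ k ih =>
    constructor
    · rintro ⟨w, hw, h⟩
      obtain ⟨α, h1, h2, h3⟩ := ih.mp h
      have hsum : ∀ h, partialSum β (Fin.cons (w - β) α : Fin (k + 1) → V) (h + 1) =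
          partialSum w α h := fun h => by simp [partialSum_succ]
      refine ⟨Fin.cons (w - β) α, Fin.cases hw.2 h1, fun h k1 k2 => ?_, (hsum k).trans h3⟩
      obtain ⟨h, rfl⟩ := Nat.exists_eq_add_of_le' k1
      rw [hsum]
      rcases h.eq_zero_or_pos with rfl | h0
      · rw [partialSum_zero]
        exact hw.1
      · exact h2 h h0 (by omega)
    · rintro ⟨α, h1, h2, h3⟩
      refine ⟨β + α 0, ⟨?_, by simpa using h1 0⟩, ih.mpr ⟨fun i => α i.succ, fun i => h1 _,
        fun h k1 k2 => ?_, ?_⟩⟩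
      · simpa [partialSum_succ, partialSum_zero] using h2 1 le_rfl (by omega)
      · rw [← partialSum_succ]
        exact h2 _ (by omega) (by omega)
      · rwa [← partialSum_succ]

end Reach

/-- Every `β ∈ Q` with `σ(β) ∉ Q` whose Levi order is finite has `q^σ(β) ≤ 3`:
a fundamental and weakly nondegenerate real orbit of a real form in a complex flag
manifold has Levi order at most `3`. -/
theorem leviOrder_le_three
    (R : Set V) (hR : IsRootSystem R)
    (ξ : V →ₗ[ℝ] ℝ) (hξ : ∀ α ∈ R, ∃ n : ℤ, ξ α = (n : ℝ))
    (Q : Set V) (hQ : Q = {α ∈ R | ξ α ≤ 0})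
    (σ : V →ₗ[ℝ] V) (hσ : σ ∘ₗ σ = LinearMap.id) (hσR : σ '' R = R)
    (β : V) (hβ : β ∈ Q) (hσβ : σ β ∉ Q)
    (hfin : leviOrder R Q σ β ≠ ⊤) :
    leviOrder R Q σ β ≤ 3 := by
  subst hQ
  have hσmem : ∀ α ∈ R, σ α ∈ R := fun α hα => hσR ▸ Set.mem_image_of_mem σ hα
  have mem_iff : ∀ α, (α ∈ R ∧ σ α ∈ {α ∈ R | ξ α ≤ 0}) ↔ (α ∈ R ∧ (ξ ∘ₗ σ) α ≤ 0) :=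
    fun α => ⟨fun h => ⟨h.1, h.2.2⟩, fun h => ⟨h.1, hσmem α h.1, h.2⟩⟩
  have chain_iff : ∀ k : ℕ, (∃ α : Fin k → V, IsLeviChain R {α ∈ R | ξ α ≤ 0} σ β α) ↔
      ∃ γ, RootReach R (ξ ∘ₗ σ) k β γ ∧ γ ∉ {α ∈ R | ξ α ≤ 0} ∧ σ γ ∉ {α ∈ R | ξ α ≤ 0} := by
    intro k
    simp only [IsLeviChain, rootReach_iff, mem_iff]
    constructor
    · rintro ⟨α, h1, h2, h3⟩
      exact ⟨_, ⟨α, h1, h2, rfl⟩, h3⟩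
    · rintro ⟨γ, ⟨α, h1, h2, rfl⟩, h3⟩
      exact ⟨α, h1, h2, h3⟩
  have hex : ∃ k : ℕ, ∃ γ, RootReach R (ξ ∘ₗ σ) k β γ ∧ γ ∉ {α ∈ R | ξ α ≤ 0} ∧
      σ γ ∉ {α ∈ R | ξ α ≤ 0} := by
    by_contra hno
    refine hfin (sInf_eq_top.mpr ?_)
    rintro m ⟨k, α, rfl, h⟩
    exact absurd ⟨k, (chain_iff k).mp ⟨α, h⟩⟩ hno
  classical
  obtain ⟨γ, hγ, hγQ⟩ := Nat.find_spec hex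
  obtain ⟨α, hα⟩ := (chain_iff _).mpr (Nat.find_spec hex)
  have hle : leviOrder R {α ∈ R | ξ α ≤ 0} σ β ≤ (Nat.find hex : ℕ∞) := sInf_le ⟨_, α, rfl, hα⟩
  refine hle.trans ?_
  suffices Nat.find hex ≤ 3 by exact_mod_cast this
  by_contra! hlt
  obtain ⟨j, hj⟩ := Nat.exists_eq_add_of_le (show 4 ≤ Nat.find hex from hlt)
  have hγR : γ ∈ R := by
    obtain ⟨α', -, h2, rfl⟩ := rootReach_iff.mp hγ
    exact h2 _ (by omega) le_rfl
  have hγpos : 0 < (ξ ∘ₗ σ) γ := by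
    by_contra! h
    exact hγQ.2 ⟨hσmem γ hγR, h⟩
  rw [hj] at hγ
  obtain ⟨w, hw1, hw2⟩ := hγ.exists_of_add
  obtain ⟨m, hm, hw3⟩ := hw1.exists_le_three hR hβ.1 (hγpos.trans_le hw2.le)
  exact Nat.find_min hex (m := m + j) (by omega) ⟨γ, hw3.trans hw2, hγQ⟩
end
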